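/- Let a < b, K ≥ 0, let g : [a,b] → ℝ be continuously differentiable, let H be the Heaviside function, let α₁, α₂, β₁, β₂ ∈ ℝ, and let w be the unique four-times continuously differentiable solution of w⁗(x) = −K(w(x)−g(x)) H(w(x)−g(x)) on [a,b] with w(a) = α₁, w(b) = α₂, w''(a) = β₁, w''(b) = β₂. For N ∈ ℕ with N ≥ 4 and h = (b−a)/(N+1), let xᵢ = a + ih, let 𝓦^true = (w(x₁), …, w(x_N)) ∈ ℝᴺ, and let 𝓦 ∈ ℝᴺ be the unique solution of (𝓐 + (h⁴K/2) I) 𝓦 = 𝓑̄ + (h⁴K/2) 𝓖 − (h⁴K/2) |𝓦 − 𝓖|, where 𝓖 = (g(x₁), …, g(x_N)), 𝓐 is the N×N pentadiagonal matrix with diagonal (5, 6, …, 6, 5), first off-diagonals −4, second off-diagonals 1, and 𝓑̄ ∈ ℝᴺ has entries 𝓑̄₁ = −β₁h² + 2α₁ − (h⁴/12) f(x₀, α₁), 𝓑̄₂ = −α₁, 𝓑̄ᵢ = 0 for 3 ≤ i ≤ N−2, 𝓑̄_{N−1} = −α₂, 𝓑̄_N = −β₂h² + 2α₂ − (h⁴/12)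 f(x_{N+1}, α₂), with f(x,y) = −K(y−g(x))H(y−g(x)). Then there exists a constant C̃ > 0, independent of N, such that ‖𝓦^true − 𝓦‖₂ ≤ C̃ √h for all such N. -/

import Mathlib

open Matrix Set

/-- The Heaviside function, with `H x = 1` for `x ≥ 0` and `H x = 0` for `x < 0`. -/
noncomputable def Heav (x : ℝ) : ℝ := if 0 ≤ x then 1 else 0

/-- The `N × N` pentadiagonal finite-difference matrix `𝓐` with diagonal `(5, 6, …, 6, 5)`,
first off-diagonals `−4`, and second off-diagonals `1`. -/
def penta (N : ℕ) : Matrix (Fin N) (Fin N) ℝ :=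
  Matrix.of fun i j =>
    if i = j then (if i.val = 0 ∨ i.val = N - 1 then 5 else 6)
    else if i.val + 1 = j.val ∨ j.val + 1 = i.val then -4
    else if i.val + 2 = j.val ∨ j.val + 2 = i.val then 1
    else 0

/-- The boundary-data vector `𝓑̄` of the finite-difference discretization (with `0`-based
indices, `h = (b-a)/(N+1)`, `x₀ = a`, `x_{N+1} = b`). -/
noncomputable def Bvec (a b α₁ α₂ β₁ β₂ : ℝ) (f : ℝ → ℝ → ℝ) (N : ℕ) : Fin N → ℝ :=
  fun i =>
    if i.val = 0 then -β₁ * ((b - a) / (N + 1)) ^ 2 + 2 * α₁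
        - ((b - a) / (N + 1)) ^ 4 / 12 * f a α₁
    else if i.val = N - 1 then -β₂ * ((b - a) / (N + 1)) ^ 2 + 2 * α₂
        - ((b - a) / (N + 1)) ^ 4 / 12 * f b α₂
    else if i.val = 1 then -α₁
    else if i.val = N - 2 then -α₂
    else 0

lemma penta_mulVec_apply {N : ℕ} (G : ℕ → ℝ) (i : Fin N) :
    (penta N *ᵥ fun j => G j) i =
      (if 2 ≤ i.val then G (i - 2) else 0) - 4 * (if 1 ≤ i.val then G (i - 1) else 0)
        + (if i.val = 0 ∨ i.val = N - 1 then 5 else 6) * G i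
        - 4 * (if i.val + 1 < N then G (i + 1) else 0)
        + (if i.val + 2 < N then G (i + 2) else 0) := by
  obtain ⟨i, hi⟩ := i
  have hrow : (penta N *ᵥ fun j => G j) ⟨i, hi⟩ = ∑ j ∈ Finset.range N,
      ((if i - 2 = j then (if 2 ≤ i then G (i - 2) else 0) else 0)
        - 4 * (if i - 1 = j then (if 1 ≤ i then G (i - 1) else 0) else 0)
        + (if i = j then (if i = 0 ∨ i = N - 1 then 5 else 6) * G i else 0)
        - 4 * (if i + 1 = j then G (i + 1) else 0)
        + (if i + 2 = j then G (i + 2) else 0)) := by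
    rw [← Fin.sum_univ_eq_sum_range]
    simp only [mulVec, dotProduct]
    refine Finset.sum_congr rfl fun j _ => ?_
    obtain ⟨j, hj⟩ := j
    simp only [penta, Matrix.of_apply, Fin.mk.injEq]
    obtain h | h | h | h | h | h : i = j ∨ i + 1 = j ∨ j + 1 = i ∨ i + 2 = j ∨ j + 2 = i ∨
      (i ≠ j ∧ i + 1 ≠ j ∧ j + 1 ≠ i ∧ i + 2 ≠ j ∧ j + 2 ≠ i) := by omega
    · subst h
      by_cases h0 : i = 0
      · simp [h0]
      · have h1 : i - 1 ≠ i := by omega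
        have h2 : i - 2 ≠ i := by omega
        simp [h1, h2]
    · subst h
      have h1 : i - 1 ≠ i + 1 := by omega
      have h2 : i - 2 ≠ i + 1 := by omega
      simp [h1, h2]
    · subst h
      have h2 : j + 1 - 2 = j → ¬ 2 ≤ j + 1 := by omega
      have h3 : j + 1 + 1 ≠ j := by omega
      have h4 : j + 1 + 2 ≠ j := by omega
      simp +contextual [h2, h3, h4]
    · subst h
      have h1 : i - 1 ≠ i + 2 := by omega
      have h2 : i - 2 ≠ i + 2 := by omega
      have h3 : i + 2 + 1 ≠ i := by omega
      simp [h1, h2, h3]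
    · subst h
      have h3 : j + 2 + 1 ≠ j := by omega
      have h4 : j + 2 + 2 ≠ j := by omega
      simp [h3, h4]
    · have h1 : i - 1 = j → ¬ 1 ≤ i := by omega
      have h2 : i - 2 = j → ¬ 2 ≤ i := by omega
      simp only [h, false_or, if_false, zero_mul]
      by_cases h3 : i - 1 = j <;> by_cases h4 : i - 2 = j <;> simp_all
  rw [hrow]
  simp only [Finset.sum_add_distrib, Finset.sum_sub_distrib, ← Finset.mul_sum,
    Finset.sum_ite_eq, Finset.mem_range, hi, show i - 1 < N by omega, show i - 2 < N by omega,
    if_true]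

lemma sum_mul_secondDiff_comm (P Q : ℕ → ℝ) (hP : P 0 = 0) (hQ : Q 0 = 0) (n : ℕ) :
    ∑ i ∈ Finset.range n, P (i + 1) * (2 * Q (i + 1) - Q i - Q (i + 2)) =
      ∑ i ∈ Finset.range n, Q (i + 1) * (2 * P (i + 1) - P i - P (i + 2))
        + (Q n * P (n + 1) - P n * Q (n + 1)) := by
  induction n with
  | zero => simp [hP, hQ]
  | succ n ih => rw [Finset.sum_range_succ, Finset.sum_range_succ, ih]; ring

lemma sum_mul_secondDiff_self (E : ℕ → ℝ) (hE : E 0 = 0) (n : ℕ) :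
    ∑ i ∈ Finset.range n, E (i + 1) * (2 * E (i + 1) - E i - E (i + 2)) =
      ∑ i ∈ Finset.range n, (E (i + 1) - E i) ^ 2 + E n * (E n - E (n + 1)) := by
  induction n with
  | zero => simp [hE]
  | succ n ih => rw [Finset.sum_range_succ, Finset.sum_range_succ, ih]; ring

/-- Discrete Poincaré inequality. -/
lemma sum_sq_le_sq_mul_sum_diff_sq (E : ℕ → ℝ) (hE : E 0 = 0) (n : ℕ) :
    ∑ i ∈ Finset.range n, E (i + 1) ^ 2 ≤
      (n : ℝ) ^ 2 * ∑ i ∈ Finset.range n, (E (i + 1) - E i) ^ 2 := by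
  set S := ∑ i ∈ Finset.range n, (E (i + 1) - E i) ^ 2
  have hS : 0 ≤ S := Finset.sum_nonneg fun i _ => sq_nonneg _
  have hpt : ∀ i ∈ Finset.range n, E (i + 1) ^ 2 ≤ n * S := by
    intro i hi
    have hi' : i + 1 ≤ n := Finset.mem_range.mp hi
    have h1 := sq_sum_le_card_mul_sum_sq (s := Finset.range (i + 1))
      (f := fun k => E (k + 1) - E k)
    rw [Finset.sum_range_sub, hE, sub_zero, Finset.card_range] at h1
    have h2 : ∑ k ∈ Finset.range (i + 1), (E (k + 1) - E k) ^ 2 ≤ S :=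
      Finset.sum_le_sum_of_subset_of_nonneg (Finset.range_mono hi') fun _ _ _ => sq_nonneg _
    have h3 : ((i + 1 : ℕ) : ℝ) ≤ n := by exact_mod_cast hi'
    exact h1.trans (mul_le_mul h3 h2 (Finset.sum_nonneg fun _ _ => sq_nonneg _) (by positivity))
  calc _ ≤ ∑ _i ∈ Finset.range n, (n : ℝ) * S := Finset.sum_le_sum hpt
    _ = _ := by simp; ring

lemma penta_coercive {N : ℕ} (hN : 2 ≤ N) (e : Fin N → ℝ) :
    ∑ i, e i ^ 2 ≤ (N : ℝ) ^ 4 * ∑ i, e i * (penta N *ᵥ e) i := by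
  set E : ℕ → ℝ := fun k => if h : 1 ≤ k ∧ k ≤ N then e ⟨k - 1, by omega⟩ else 0 with hE
  have hEe : ∀ i : Fin N, E (i + 1) = e i := by
    intro i
    have : i.val + 1 ≤ N := i.2
    simp [hE, this]
  have hE0 : E 0 = 0 := by simp [hE]
  have hEN : E (N + 1) = 0 := by simp [hE]
  set U : ℕ → ℝ := fun k =>
    if 1 ≤ k ∧ k ≤ N then 2 * E k - E (k - 1) - E (k + 1) else 0 with hU
  have hU0 : U 0 = 0 := by simp [hU]
  have hUN : U (N + 1) = 0 := by simp [hU]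
  have hUs : ∀ i ∈ Finset.range N, U (i + 1) = 2 * E (i + 1) - E i - E (i + 2) := by
    intro i hi
    have : i + 1 ≤ N := Finset.mem_range.mp hi
    simp [hU, this]
  have hpenta : ∀ i : Fin N, (penta N *ᵥ e) i = 2 * U (i + 1) - U i - U (i + 2) := by
    intro i
    have he : e = fun j : Fin N => (fun k => E (k + 1)) j := by ext j; exact (hEe j).symm
    rw [he, penta_mulVec_apply fun k => E (k + 1)]
    obtain ⟨i, hi⟩ := i
    have hi1 : i + 1 ≤ N := hi
    have hEz : ∀ k, N < k → E k = 0 := fun k hk => by simp [hE, not_le.mpr hk]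
    simp only [hU]
    clear_value E
    clear hUs hU0 hUN hU U he hEe hE e
    rcases i with _ | _ | k <;> grind
  have hY : ∑ i, e i * (penta N *ᵥ e) i = ∑ i ∈ Finset.range N, U (i + 1) ^ 2 := by
    have := sum_mul_secondDiff_comm E U hE0 hU0 N
    rw [hEN, hUN, mul_zero, mul_zero, sub_zero, add_zero] at this
    rw [Finset.sum_congr rfl fun i _ => by rw [hpenta i, ← hEe i],
      Fin.sum_univ_eq_sum_range (fun i => E (i + 1) * (2 * U (i + 1) - U i - U (i + 2))), this]
    exact Finset.sum_congr rfl fun i hi => by rw [← hUs i hi]; ring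
  have hX : ∑ i, e i ^ 2 = ∑ i ∈ Finset.range N, E (i + 1) ^ 2 := by
    rw [← Fin.sum_univ_eq_sum_range (fun i => E (i + 1) ^ 2)]
    simp only [hEe]
  rw [hX, hY]
  set X := ∑ i ∈ Finset.range N, E (i + 1) ^ 2
  set Y := ∑ i ∈ Finset.range N, U (i + 1) ^ 2
  set Z := ∑ i ∈ Finset.range N, E (i + 1) * U (i + 1)
  have hX0 : 0 ≤ X := Finset.sum_nonneg fun i _ => sq_nonneg _
  have hY0 : 0 ≤ Y := Finset.sum_nonneg fun i _ => sq_nonneg _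
  have hXZ : X ≤ (N : ℝ) ^ 2 * Z := by
    refine (sum_sq_le_sq_mul_sum_diff_sq E hE0 N).trans ?_
    have h1 := sum_mul_secondDiff_self E hE0 N
    rw [hEN, sub_zero, Finset.sum_congr rfl fun i hi => by rw [← hUs i hi]] at h1
    have : 0 ≤ E N * E N := mul_self_nonneg _
    exact mul_le_mul_of_nonneg_left (by linarith) (by positivity)
  have hZ : Z ^ 2 ≤ X * Y := Finset.sum_mul_sq_le_sq_mul_sq _ _ _
  rcases hX0.eq_or_lt with h | h
  · rw [← h]; positivity
  · have h2 : X * X ≤ X * ((N : ℝ) ^ 4 * Y) := by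
      calc X * X ≤ ((N : ℝ) ^ 2 * Z) * ((N : ℝ) ^ 2 * Z) := mul_self_le_mul_self hX0 hXZ
        _ = (N : ℝ) ^ 4 * Z ^ 2 := by ring
        _ ≤ (N : ℝ) ^ 4 * (X * Y) := by gcongr
        _ = _ := by ring
    exact le_of_mul_le_mul_left h2 h

lemma abs_le_of_hasDerivWithinAt_of_abs_le {a b c M : ℝ} {n : ℕ} {r r' : ℝ → ℝ}
    (hc : c ∈ Icc a b) (hr : ∀ x ∈ Icc a b, HasDerivWithinAt r (r' x) (Icc a b) x)
    (hrc : r c = 0) (hM : 0 ≤ M) (hr' : ∀ x ∈ Icc a b, |r' x| ≤ M * |x - c| ^ n) :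
    ∀ x ∈ Icc a b, |r x| ≤ M * |x - c| ^ (n + 1) := by
  intro x hx
  have hsub : uIcc c x ⊆ Icc a b := uIcc_subset_Icc hc hx
  have h := (convex_uIcc c x).norm_image_sub_le_of_norm_hasDerivWithin_le
    (f := r) (f' := r') (C := M * |x - c| ^ n)
    (fun y hy => (hr y (hsub hy)).mono hsub)
    (fun y hy => (hr' y (hsub hy)).trans <| by
      have := abs_sub_left_of_mem_uIcc hy
      gcongr)
    left_mem_uIcc right_mem_uIcc
  rw [hrc, sub_zero, Real.norm_eq_abs, Real.norm_eq_abs] at h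
  rw [pow_succ, ← mul_assoc]
  exact h

/-- Fourth-order Taylor expansion with a Lipschitz fourth derivative. -/
lemma abs_sub_taylor_four_le {a b c L : ℝ} {f0 f1 f2 f3 f4 : ℝ → ℝ} (hc : c ∈ Icc a b)
    (hL : 0 ≤ L)
    (h0 : ∀ x ∈ Icc a b, HasDerivWithinAt f0 (f1 x) (Icc a b) x)
    (h1 : ∀ x ∈ Icc a b, HasDerivWithinAt f1 (f2 x) (Icc a b) x)
    (h2 : ∀ x ∈ Icc a b, HasDerivWithinAt f2 (f3 x) (Icc a b) x)
    (h3 : ∀ x ∈ Icc a b, HasDerivWithinAt f3 (f4 x) (Icc a b) x)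
    (h4 : ∀ x ∈ Icc a b, ∀ y ∈ Icc a b, |f4 x - f4 y| ≤ L * |x - y|) :
    ∀ x ∈ Icc a b, |f0 x - (f0 c + f1 c * (x - c) + f2 c / 2 * (x - c) ^ 2
      + f3 c / 6 * (x - c) ^ 3 + f4 c / 24 * (x - c) ^ 4)| ≤ L * |x - c| ^ 5 := by
  have hd : ∀ (k : ℕ) (x : ℝ), HasDerivWithinAt (fun x : ℝ => (x - c) ^ (k + 1))
      ((k + 1) * (x - c) ^ k) (Icc a b) x := by
    intro k x
    convert! (((hasDerivAt_id x).sub_const c).pow (k + 1)).hasDerivWithinAt (s := Icc a b) using 1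
    simp
  have hd1 : ∀ x : ℝ, HasDerivWithinAt (fun x : ℝ => x - c) 1 (Icc a b) x :=
    fun x => ((hasDerivAt_id x).sub_const c).hasDerivWithinAt
  have r3 := abs_le_of_hasDerivWithinAt_of_abs_le (n := 1) (M := L) hc
    (r := fun x => f3 x - (f3 c + f4 c * (x - c))) (r' := fun x => f4 x - f4 c)
    (fun x hx => by
      convert! (h3 x hx).sub (((hd1 x).const_mul (f4 c)).const_add (f3 c)) using 1; ring)
    (by ring) hL (fun x hx => by simpa using h4 x hx c hc)
  have r2 := abs_le_of_hasDerivWithinAt_of_abs_le (n := 2) (M := L) hc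
    (r := fun x => f2 x - (f2 c + f3 c * (x - c) + f4 c / 2 * (x - c) ^ 2))
    (fun x hx => by
      convert! (h2 x hx).sub ((((hd1 x).const_mul (f3 c)).const_add (f2 c)).add
        ((hd 1 x).const_mul (f4 c / 2))) using 1
      norm_num; ring)
    (by ring) hL r3
  have r1 := abs_le_of_hasDerivWithinAt_of_abs_le (n := 3) (M := L) hc
    (r := fun x => f1 x - (f1 c + f2 c * (x - c) + f3 c / 2 * (x - c) ^ 2
      + f4 c / 6 * (x - c) ^ 3))
    (fun x hx => by
      convert! (h1 x hx).sub (((((hd1 x).const_mul (f2 c)).const_add (f1 c)).add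
        ((hd 1 x).const_mul (f3 c / 2))).add ((hd 2 x).const_mul (f4 c / 6))) using 1
      norm_num; ring)
    (by ring) hL r2
  exact abs_le_of_hasDerivWithinAt_of_abs_le (n := 4) (M := L) hc
    (fun x hx => by
      convert! (h0 x hx).sub ((((((hd1 x).const_mul (f1 c)).const_add (f0 c)).add
        ((hd 1 x).const_mul (f2 c / 2))).add ((hd 2 x).const_mul (f3 c / 6))).add
        ((hd 3 x).const_mul (f4 c / 24))) using 1
      norm_num; ring)
    (by ring) hL r1

lemma interior_stencil_error {s : Set ℝ} {f0 f1 f2 f3 f4 : ℝ → ℝ} {L h c : ℝ} (hh : 0 ≤ h)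
    (hT : ∀ x ∈ s, |f0 x - (f0 c + f1 c * (x - c) + f2 c / 2 * (x - c) ^ 2
      + f3 c / 6 * (x - c) ^ 3 + f4 c / 24 * (x - c) ^ 4)| ≤ L * |x - c| ^ 5)
    (hm2 : c - 2 * h ∈ s) (hm1 : c - h ∈ s) (hp1 : c + h ∈ s) (hp2 : c + 2 * h ∈ s) :
    |f0 (c - 2 * h) - 4 * f0 (c - h) + 6 * f0 c - 4 * f0 (c + h) + f0 (c + 2 * h)
      - h ^ 4 * f4 c| ≤ 72 * L * h ^ 5 := by
  have h2 : 0 ≤ 2 * h := by positivity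
  have e1 := hT _ hm2
  have e2 := hT _ hm1
  have e3 := hT _ hp1
  have e4 := hT _ hp2
  rw [show c - 2 * h - c = -(2 * h) by ring, abs_neg, abs_of_nonneg h2] at e1
  rw [show c - h - c = -h by ring, abs_neg, abs_of_nonneg hh] at e2
  rw [show c + h - c = h by ring, abs_of_nonneg hh] at e3
  rw [show c + 2 * h - c = 2 * h by ring, abs_of_nonneg h2] at e4
  rw [abs_le] at *
  constructor <;> linarith

lemma boundary_stencil_error {s : Set ℝ} {f0 f1 f2 f3 f4 : ℝ → ℝ} {L h c : ℝ}
    (hT : ∀ x ∈ s, |f0 x - (f0 c + f1 c * (x - c) + f2 c / 2 * (x - c) ^ 2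
      + f3 c / 6 * (x - c) ^ 3 + f4 c / 24 * (x - c) ^ 4)| ≤ L * |x - c| ^ 5)
    (h4 : |f4 (c + h) - f4 c| ≤ L * |h|)
    (hp1 : c + h ∈ s) (hp2 : c + 2 * h ∈ s) (hp3 : c + 3 * h ∈ s) :
    |5 * f0 (c + h) - 4 * f0 (c + 2 * h) + f0 (c + 3 * h)
      - (-f2 c * h ^ 2 + 2 * f0 c - h ^ 4 / 12 * f4 c) - h ^ 4 * f4 (c + h)|
      ≤ 377 * L * |h| ^ 5 := by
  have e1 := hT _ hp1
  have e2 := hT _ hp2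
  have e3 := hT _ hp3
  rw [show c + h - c = h by ring] at e1
  rw [show c + 2 * h - c = 2 * h by ring, abs_mul, abs_two] at e2
  rw [show c + 3 * h - c = 3 * h by ring, abs_mul, abs_of_pos (by norm_num : (0:ℝ) < 3)] at e3
  have e4 : |h ^ 4 * (f4 (c + h) - f4 c)| ≤ L * |h| ^ 5 := by
    rw [abs_mul, abs_pow]
    calc _ ≤ |h| ^ 4 * (L * |h|) := by gcongr
      _ = _ := by ring
  rw [abs_le] at e1 e2 e3 e4 ⊢
  constructor <;> linarith

lemma penta_truncation_error {a b L : ℝ} {N : ℕ} (hN : 4 ≤ N) (hab : a < b) (hL : 0 ≤ L)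
    {f : ℝ → ℝ → ℝ} {f0 f1 f2 f3 f4 : ℝ → ℝ}
    (h0 : ∀ x ∈ Icc a b, HasDerivWithinAt f0 (f1 x) (Icc a b) x)
    (h1 : ∀ x ∈ Icc a b, HasDerivWithinAt f1 (f2 x) (Icc a b) x)
    (h2 : ∀ x ∈ Icc a b, HasDerivWithinAt f2 (f3 x) (Icc a b) x)
    (h3 : ∀ x ∈ Icc a b, HasDerivWithinAt f3 (f4 x) (Icc a b) x)
    (h4 : ∀ x ∈ Icc a b, ∀ y ∈ Icc a b, |f4 x - f4 y| ≤ L * |x - y|)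
    (hfa : f a (f0 a) = f4 a) (hfb : f b (f0 b) = f4 b) (i : Fin N) :
    |(penta N *ᵥ fun j : Fin N => f0 (a + (j.val + 1) * ((b - a) / (N + 1)))) i
      - Bvec a b (f0 a) (f0 b) (f2 a) (f2 b) f N i
      - ((b - a) / (N + 1)) ^ 4 * f4 (a + (i.val + 1) * ((b - a) / (N + 1)))|
      ≤ 377 * L * ((b - a) / (N + 1)) ^ 5 := by
  rw [penta_mulVec_apply (fun j : ℕ => f0 (a + (j + 1) * ((b - a) / (N + 1)))) i]
  simp only [Bvec]
  have hh : 0 < (b - a) / (N + 1 : ℝ) := div_pos (sub_pos.mpr hab) (by positivity)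
  have hNh : (N + 1 : ℝ) * ((b - a) / (N + 1)) = b - a := by field_simp
  set h := (b - a) / (N + 1 : ℝ)
  have hT := fun c (hc : c ∈ Icc a b) => abs_sub_taylor_four_le hc hL h0 h1 h2 h3 h4
  have hpt : ∀ k : ℕ, k ≤ N + 1 → a + k * h ∈ Icc a b := by
    intro k hk
    have hk' : (k : ℝ) ≤ N + 1 := by exact_mod_cast hk
    have hk2 : (k : ℝ) * h ≤ (N + 1) * h := by gcongr
    have hk0 : 0 ≤ (k : ℝ) * h := by positivity
    constructor <;> linarith
  have hM : 72 * L * h ^ 5 ≤ 377 * L * h ^ 5 := by gcongr; norm_num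
  have ha : a ∈ Icc a b := left_mem_Icc.mpr hab.le
  have hb : b ∈ Icc a b := right_mem_Icc.mpr hab.le
  obtain ⟨M, rfl⟩ : ∃ M, N = M + 4 := ⟨N - 4, by omega⟩
  push_cast at hNh
  obtain ⟨i, hi⟩ := i
  obtain rfl | rfl | rfl | rfl | ⟨k, rfl, hk⟩ :
      i = 0 ∨ i = M + 3 ∨ i = 1 ∨ i = M + 2 ∨ ∃ k, i = k + 2 ∧ k < M := by
    rcases i with _ | _ | k
    · simp
    · simp
    · have : k + 2 = M + 3 ∨ k + 2 = M + 2 ∨ k < M := by omega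
      rcases this with h | h | h
      · exact Or.inr (Or.inl h)
      · exact Or.inr (Or.inr (Or.inr (Or.inl h)))
      · exact Or.inr (Or.inr (Or.inr (Or.inr ⟨k, rfl, h⟩)))
  · have p1 : a + h ∈ Icc a b := by simpa using hpt 1 (by omega)
    have p2 : a + 2 * h ∈ Icc a b := by simpa using hpt 2 (by omega)
    have p3 : a + 3 * h ∈ Icc a b := by simpa using hpt 3 (by omega)
    have e := boundary_stencil_error (hT a ha) (by simpa using h4 _ p1 _ ha) p1 p2 p3
    rw [abs_of_pos hh] at e
    convert! e using 2
    norm_num [hfa]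
  · have r1 : b + -h = a + (M + 3 + 1) * h := by linarith
    have r2 : b + 2 * -h = a + (M + 2 + 1) * h := by linarith
    have r3 : b + 3 * -h = a + (M + 1 + 1) * h := by linarith
    have p1 : b + -h ∈ Icc a b := by
      rw [r1]; convert hpt (M + 4) (by omega) using 3; push_cast; ring
    have p2 : b + 2 * -h ∈ Icc a b := by
      rw [r2]; convert hpt (M + 3) (by omega) using 3; push_cast; ring
    have p3 : b + 3 * -h ∈ Icc a b := by
      rw [r3]; convert hpt (M + 2) (by omega) using 3; push_cast; ring
    have e := boundary_stencil_error (hT b hb) (by simpa using h4 _ p1 _ hb) p1 p2 p3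
    rw [abs_neg, abs_of_pos hh] at e
    rw [r1, r2, r3] at e
    convert! e using 2
    norm_num [hfb]
    ring_nf
  · have p0 : a + 1 * h ∈ Icc a b := by simpa using hpt 1 (by omega)
    have p1 : a + (1 + 1) * h ∈ Icc a b := by
      convert hpt 2 (by omega) using 3; norm_num
    have p2 : a + 3 * h ∈ Icc a b := by simpa using hpt 3 (by omega)
    have p3 : a + 4 * h ∈ Icc a b := by simpa using hpt 4 (by omega)
    have q0 : a + (1 + 1) * h - h = a + 1 * h := by ring
    have q1 : a + (1 + 1) * h + h = a + 3 * h := by ring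
    have q2 : a + (1 + 1) * h + 2 * h = a + 4 * h := by ring
    have q3 : a + (1 + 1) * h - 2 * h = a := by ring
    have e := interior_stencil_error (h := h) (c := a + (1 + 1) * h) hh.le (hT _ p1)
      (by rwa [q3]) (by rwa [q0]) (by rwa [q1]) (by rwa [q2])
    rw [q0, q1, q2, q3] at e
    refine le_trans (le_of_eq ?_) (e.trans hM)
    congr 1
    norm_num
    ring_nf
  · have p0 := hpt (M + 1) (by omega)
    have p1 := hpt (M + 2) (by omega)
    have p2 := hpt (M + 3) (by omega)
    have p3 := hpt (M + 4) (by omega)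
    push_cast at p0 p1 p2 p3
    have q0 : a + (M + 2 + 1) * h - h = a + (M + 1 + 1) * h := by ring
    have q1 : a + (M + 2 + 1) * h + h = a + (M + 3 + 1) * h := by ring
    have q2 : a + (M + 2 + 1) * h + 2 * h = b := by linarith
    have q3 : a + (M + 2 + 1) * h - 2 * h = a + (M + 1) * h := by ring
    have e := interior_stencil_error (h := h) (c := a + (M + 2 + 1) * h) hh.le
      (hT _ (by convert p2 using 1; ring))
      (by rwa [q3]) (by rw [q0]; convert p1 using 1; ring)
      (by rw [q1]; convert p3 using 1; ring) (by rwa [q2])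
    rw [q0, q1, q2, q3] at e
    refine le_trans (le_of_eq ?_) (e.trans hM)
    congr 1
    norm_num [show M + 2 ≠ 1 by omega, show M + 4 - 2 = M + 2 by omega]
    ring_nf
  · have p0 := hpt (k + 1) (by omega)
    have p1 := hpt (k + 2) (by omega)
    have p2 := hpt (k + 3) (by omega)
    have p3 := hpt (k + 4) (by omega)
    have p4 := hpt (k + 5) (by omega)
    push_cast at p0 p1 p2 p3 p4
    have q0 : a + (k + 2 + 1) * h - h = a + (k + 1 + 1) * h := by ring
    have q1 : a + (k + 2 + 1) * h + h = a + (k + 3 + 1) * h := by ring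
    have q2 : a + (k + 2 + 1) * h + 2 * h = a + (k + 4 + 1) * h := by ring
    have q3 : a + (k + 2 + 1) * h - 2 * h = a + (k + 1) * h := by ring
    have e := interior_stencil_error (h := h) (c := a + (k + 2 + 1) * h) hh.le
      (hT _ (by convert p2 using 1; ring))
      (by rwa [q3]) (by rw [q0]; convert p1 using 1; ring)
      (by rw [q1]; convert p3 using 1; ring) (by rw [q2]; convert p4 using 1; ring)
    rw [q0, q1, q2, q3] at e
    refine le_trans (le_of_eq ?_) (e.trans hM)
    congr 1
    have n1 : k ≠ M + 1 := by omega
    have n2 : k ≠ M := by omega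
    have n3 : k + 2 + 1 < M + 4 := by omega
    have n4 : k + 2 + 2 < M + 4 := by omega
    norm_num [n1, n2, n3, n4, show k + 2 ≠ 1 by omega, show M + 4 - 2 = M + 2 by omega]
    ring_nf

/-- Stability of the pentadiagonal operator under a monotone perturbation. -/
lemma sum_sq_le_of_mul_penta_le {N : ℕ} (hN : 2 ≤ N) (e : Fin N → ℝ) {T : ℝ}
    (he : ∀ i, e i * (penta N *ᵥ e) i ≤ |e i| * T) :
    ∑ i, e i ^ 2 ≤ (N : ℝ) ^ 9 * T ^ 2 := by
  have hX := (penta_coercive hN e).trans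
    (mul_le_mul_of_nonneg_left (Finset.sum_le_sum fun i _ => he i) (by positivity))
  have hCS := Finset.sum_mul_sq_le_sq_mul_sq Finset.univ (fun i => |e i|) (fun _ : Fin N => T)
  simp only [sq_abs, Finset.sum_const, Finset.card_univ, Fintype.card_fin, nsmul_eq_mul] at hCS
  have hX0 : 0 ≤ ∑ i, e i ^ 2 := Finset.sum_nonneg fun i _ => sq_nonneg _
  set X := ∑ i, e i ^ 2
  set Q := ∑ i, |e i| * T
  rcases hX0.eq_or_lt with h | h
  · rw [← h]; positivity
  · have h2 : X * X ≤ X * ((N : ℝ) ^ 9 * T ^ 2) := by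
      calc X * X ≤ ((N : ℝ) ^ 4 * Q) * ((N : ℝ) ^ 4 * Q) := mul_self_le_mul_self hX0 hX
        _ = (N : ℝ) ^ 8 * Q ^ 2 := by ring
        _ ≤ (N : ℝ) ^ 8 * (X * (N * T ^ 2)) := by gcongr
        _ = _ := by ring
    exact le_of_mul_le_mul_left h2 h

lemma mul_Heav (y : ℝ) : y * Heav y = max y 0 := by
  unfold Heav
  split_ifs with h
  · rw [mul_one, max_eq_left h]
  · rw [mul_zero, max_eq_right (not_le.mp h).le]

lemma hasDerivWithinAt_iteratedDerivWithin {a b : ℝ} (hab : a < b) {w : ℝ → ℝ} {n k : ℕ}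
    (hw : ContDiffOn ℝ n w (Icc a b)) (hk : k < n) :
    ∀ x ∈ Icc a b, HasDerivWithinAt (iteratedDerivWithin k w (Icc a b))
      (iteratedDerivWithin (k + 1) w (Icc a b) x) (Icc a b) x := by
  intro x hx
  rw [iteratedDerivWithin_succ]
  exact (hw.differentiableOn_iteratedDerivWithin (by exact_mod_cast hk)
    (uniqueDiffOn_Icc hab) x hx).hasDerivWithinAt

/-- **Convergence of the finite-difference scheme** for the contact BVP
`w⁗ = −K(w−g)H(w−g)` with `w a = α₁`, `w b = α₂`, `w'' a = β₁`, `w'' b = β₂`: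
if `w` is the (unique) exact solution and, for each `N ≥ 4`, `𝓦` is the (unique) solution
of the discrete absolute value equation, then `‖𝓦^true − 𝓦‖₂ ≤ C̃ √h` with `C̃` independent
of `N`, where `h = (b−a)/(N+1)` and `𝓦^true = (w x₁, …, w x_N)`. -/
theorem finite_difference_convergence (a b : ℝ) (hab : a < b) (K : ℝ) (hK : 0 ≤ K)
    (g : ℝ → ℝ) (hg : ContDiffOn ℝ 1 g (Set.Icc a b)) (α₁ α₂ β₁ β₂ : ℝ)
    (w : ℝ → ℝ) (hw : ContDiffOn ℝ 4 w (Set.Icc a b))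
    (hode : ∀ x ∈ Set.Icc a b, iteratedDerivWithin 4 w (Set.Icc a b) x =
      -K * (w x - g x) * Heav (w x - g x))
    (hwa : w a = α₁) (hwb : w b = α₂)
    (hwa'' : iteratedDerivWithin 2 w (Set.Icc a b) a = β₁)
    (hwb'' : iteratedDerivWithin 2 w (Set.Icc a b) b = β₂) :
    ∃ Ctil : ℝ, 0 < Ctil ∧
      ∀ N : ℕ, 4 ≤ N →
        ∀ 𝓦 : Fin N → ℝ,
          (penta N + (((b - a) / (N + 1)) ^ 4 * K / 2) •
              (1 : Matrix (Fin N) (Fin N) ℝ)) *ᵥ 𝓦 =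
            Bvec a b α₁ α₂ β₁ β₂ (fun x y => -K * (y - g x) * Heav (y - g x)) N +
              (((b - a) / (N + 1)) ^ 4 * K / 2) •
                (fun i : Fin N => g (a + (i.val + 1) * ((b - a) / (N + 1)))) -
              (((b - a) / (N + 1)) ^ 4 * K / 2) •
                (fun i : Fin N =>
                  |𝓦 i - g (a + (i.val + 1) * ((b - a) / (N + 1)))|) →
          ‖(EuclideanSpace.equiv (Fin N) ℝ).symm
              (fun i : Fin N =>
                w (a + (i.val + 1) * ((b - a) / (N + 1))) - 𝓦 i)‖ ≤
            Ctil * Real.sqrt ((b - a) / (N + 1)) := by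
  set f4 := iteratedDerivWithin 4 w (Icc a b)
  have hf4 : ∀ x ∈ Icc a b, f4 x = -K * max (w x - g x) 0 := fun x hx => by
    rw [hode x hx, mul_assoc, mul_Heav]
  obtain ⟨L', hL'⟩ := ((hw.of_le (by norm_num)).sub hg).exists_lipschitzOnWith one_ne_zero
    (convex_Icc a b) isCompact_Icc
  set L : ℝ := K * L'
  have hL : 0 ≤ L := by positivity
  have h4 : ∀ x ∈ Icc a b, ∀ y ∈ Icc a b, |f4 x - f4 y| ≤ L * |x - y| := by
    intro x hx y hy
    have h1 := hL'.dist_le_mul x hx y hy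
    rw [Real.dist_eq, Real.dist_eq] at h1
    rw [hf4 x hx, hf4 y hy, ← mul_sub, abs_mul, abs_neg, abs_of_nonneg hK, mul_assoc]
    exact mul_le_mul_of_nonneg_left ((abs_max_sub_max_le_abs _ _ _).trans h1) hK
  refine ⟨√((b - a) ^ 9) * (377 * L) + 1, by positivity, fun N hN 𝓦 h𝓦 => ?_⟩
  have hd : ∀ k < 4, _ := fun k hk => hasDerivWithinAt_iteratedDerivWithin (n := 4) hab hw hk
  have h0 := hd 0 (by norm_num)
  rw [iteratedDerivWithin_zero] at h0
  have hτ := penta_truncation_error hN hab hL (f := fun x y => -K * (y - g x) * Heav (y - g x))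
    (f2 := iteratedDerivWithin 2 w (Icc a b)) (f4 := f4) h0 (hd 1 (by norm_num)) (hd 2 (by norm_num)) (hd 3 (by norm_num)) h4
    (hode a (left_mem_Icc.mpr hab.le)).symm (hode b (right_mem_Icc.mpr hab.le)).symm
  rw [hwa, hwb, hwa'', hwb''] at hτ
  have hh : 0 < (b - a) / (N + 1 : ℝ) := div_pos (sub_pos.mpr hab) (by positivity)
  have hNh : (N + 1 : ℝ) * ((b - a) / (N + 1)) = b - a := by field_simp
  set h := (b - a) / (N + 1 : ℝ)
  have hmem : ∀ i : Fin N, a + (i.val + 1) * h ∈ Icc a b := by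
    intro i
    have hi : (i.val + 1 : ℝ) ≤ N + 1 := by exact_mod_cast Nat.succ_le_succ i.2.le
    have h1 : (i.val + 1 : ℝ) * h ≤ (N + 1) * h := by gcongr
    have h2 : 0 ≤ (i.val + 1 : ℝ) * h := by positivity
    constructor <;> linarith
  set e : Fin N → ℝ := fun i => w (a + (i.val + 1) * h) - 𝓦 i with he_def
  have hstab := sum_sq_le_of_mul_penta_le (by omega) e (T := 377 * L * h ^ 5) fun i => by
    have hWi := congrFun h𝓦 i
    simp only [add_mulVec, smul_mulVec, one_mulVec, Pi.add_apply, Pi.sub_apply, Pi.smul_apply,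
      smul_eq_mul] at hWi
    have hτi := hτ i
    rw [hf4 _ (hmem i)] at hτi
    have hpe : (penta N *ᵥ e) i = (penta N *ᵥ fun j : Fin N => w (a + (j.val + 1) * h)) i
        - (penta N *ᵥ 𝓦) i := by
      rw [← Pi.sub_apply, ← mulVec_sub]; rfl
    have hei : e i = (w (a + (i.val + 1) * h) - g (a + (i.val + 1) * h))
      - (𝓦 i - g (a + (i.val + 1) * h)) := by simp [he_def]
    generalize w (a + (i.val + 1) * h) - g (a + (i.val + 1) * h) = p at *
    have hq : |𝓦 i - g (a + (i.val + 1) * h)| = 2 * max (𝓦 i - g (a + (i.val + 1) * h)) 0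
        - (𝓦 i - g (a + (i.val + 1) * h)) := by
      rcases le_total (𝓦 i - g (a + (i.val + 1) * h)) 0 with hs | hs
      · rw [abs_of_nonpos hs, max_eq_right hs]; ring
      · rw [abs_of_nonneg hs, max_eq_left hs]; ring
    rw [hq] at hWi
    have hmono : 0 ≤ e i * (max p 0 - max (𝓦 i - g (a + (i.val + 1) * h)) 0) := by
      rw [hei]
      rcases le_total p (𝓦 i - g (a + (i.val + 1) * h)) with hs | hs
      · exact mul_nonneg_of_nonpos_of_nonpos (sub_nonpos.mpr hs)
          (sub_nonpos.mpr (max_le_max_right 0 hs))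
      · exact mul_nonneg (sub_nonneg.mpr hs) (sub_nonneg.mpr (max_le_max_right 0 hs))
    set τ := (penta N *ᵥ fun j : Fin N => w (a + (j.val + 1) * h)) i
      - Bvec a b α₁ α₂ β₁ β₂ (fun x y => -K * (y - g x) * Heav (y - g x)) N i
      - h ^ 4 * (-K * max p 0) with hτ_def
    have hsplit : e i * (penta N *ᵥ e) i = e i * τ - h ^ 4 * K * (e i *
        (max p 0 - max (𝓦 i - g (a + (i.val + 1) * h)) 0)) := by
      rw [hpe, eq_sub_of_add_eq hWi, hτ_def]
      ring
    calc e i * (penta N *ᵥ e) i ≤ e i * τ := by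
          rw [hsplit]; exact sub_le_self _ (by positivity)
      _ ≤ |e i| * |τ| := by rw [← abs_mul]; exact le_abs_self _
      _ ≤ |e i| * (377 * L * h ^ 5) := by gcongr
  have hNh9 : ((N : ℝ) * h) ^ 9 ≤ (b - a) ^ 9 := by
    gcongr
    linarith
  rw [EuclideanSpace.norm_eq]
  have hsum : ∑ i, e i ^ 2 ≤ (√((b - a) ^ 9) * (377 * L) * √h) ^ 2 := by
    rw [mul_pow, mul_pow, Real.sq_sqrt hh.le, Real.sq_sqrt (pow_nonneg (sub_pos.mpr hab).le _)]
    calc _ ≤ (N : ℝ) ^ 9 * (377 * L * h ^ 5) ^ 2 := hstab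
      _ = ((N : ℝ) * h) ^ 9 * ((377 * L) ^ 2 * h) := by ring
      _ ≤ (b - a) ^ 9 * ((377 * L) ^ 2 * h) := by gcongr
      _ = _ := by ring
  calc _ = √(∑ i, e i ^ 2) := by simp [he_def]
    _ ≤ √((b - a) ^ 9) * (377 * L) * √h := Real.sqrt_le_iff.mpr ⟨by positivity, hsum⟩
    _ ≤ _ := by gcongr; linarith
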